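/- Let n ≥ 1 and let X, Y : Fin n → ℝ be two samples. For any two distinct indices i, j, the covariance of X with Y ∘ (swap i j) satisfies cov(X, Y ∘ swap i j) − cov(X, Y) = (1/n) · (X i − X j) · (Y j − Y i). -/

import Mathlib

/-- Mean of a sample of `n` real values. -/
noncomputable def sampleMean (n : ℕ) (X : Fin n → ℝ) : ℝ :=
  (1 / (n : ℝ)) * ∑ i, X i

/-- Covariance of two samples of `n` real values. -/
noncomputable def sampleCov (n : ℕ) (X Y : Fin n → ℝ) : ℝ :=
  (1 / (n : ℝ)) * ∑ i, (X i - sampleMean n X) * (Y i - sampleMean n Y)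

/-- Permuting a sample does not change its mean. -/
theorem sampleMean_comp_perm (n : ℕ) (Y : Fin n → ℝ) (σ : Equiv.Perm (Fin n)) :
    sampleMean n (Y ∘ σ) = sampleMean n Y := by
  simp only [sampleMean, Function.comp_apply, Equiv.sum_comp σ Y]

/-- Swapping the `Y`-values of two distinct samples changes the covariance by
`(1/n) · (X i − X j) · (Y j − Y i)`. -/
theorem cov_swap_diff (n : ℕ) (hn : 1 ≤ n) (X Y : Fin n → ℝ) (i j : Fin n)
    (hij : i ≠ j) :
    sampleCov n X (Y ∘ Equiv.swap i j) - sampleCov n X Y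
      = (1 / (n : ℝ)) * (X i - X j) * (Y j - Y i) := by
  rw [sampleCov, sampleCov, sampleMean_comp_perm, ← mul_sub, ← Finset.sum_sub_distrib,
    Fintype.sum_eq_add i j hij]
  · simp only [Function.comp_apply, Equiv.swap_apply_left, Equiv.swap_apply_right]
    ring
  · rintro k ⟨hki, hkj⟩
    simp only [Function.comp_apply, Equiv.swap_apply_of_ne_of_ne hki hkj, sub_self]
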